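/- There is a constant C > 0 depending only on n such that for every λ ≥ 1 and every torus eigenfunction φ with frequency λ normalized by ∫_{[0,1)ⁿ} φ² dx = 1, one has ∫_{Z_φ} |∇φ|² dH^{n−1} ≤ C λ³. -/

import Mathlib

open MeasureTheory
open scoped ENNReal

/-- The Euclidean Laplacian, as the sum of second partial derivatives. -/
noncomputable def lap {n : ℕ} (φ : EuclideanSpace ℝ (Fin n) → ℝ)
    (x : EuclideanSpace ℝ (Fin n)) : ℝ :=
  ∑ i, fderiv ℝ (fun y => fderiv ℝ φ y (EuclideanSpace.single i 1)) x (EuclideanSpace.single i 1)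

/-- A function on ℝⁿ is ℤⁿ-periodic if it is invariant under translation by
every integer vector. -/
def ZnPeriodic {n : ℕ} (φ : EuclideanSpace ℝ (Fin n) → ℝ) : Prop :=
  ∀ (x : EuclideanSpace ℝ (Fin n)) (k : Fin n → ℤ),
    φ (x + (WithLp.equiv 2 (Fin n → ℝ)).symm fun i => (k i : ℝ)) = φ x

/-- The fundamental domain [0,1)ⁿ of the torus ℝⁿ/ℤⁿ. -/
def fund (n : ℕ) : Set (EuclideanSpace ℝ (Fin n)) := {x | ∀ i, x i ∈ Set.Ico (0:ℝ) 1}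

/-- φ is a torus eigenfunction with frequency λ: smooth, ℤⁿ-periodic, not
identically zero, with Δφ = -λ²φ. -/
def IsTorusEigenfunction {n : ℕ} (lam : ℝ) (φ : EuclideanSpace ℝ (Fin n) → ℝ) : Prop :=
  ContDiff ℝ (⊤ : ℕ∞) φ ∧ ZnPeriodic φ ∧ φ ≠ 0 ∧ ∀ x, lap φ x = -lam ^ 2 * φ x

open Set Filter Topology

/-- The partial derivative of `f` in the `i`-th coordinate direction. -/
noncomputable def pd {n : ℕ} (i : Fin n) (f : EuclideanSpace ℝ (Fin n) → ℝ)
    (x : EuclideanSpace ℝ (Fin n)) : ℝ :=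
  fderiv ℝ f x (EuclideanSpace.single i 1)

section Calculus

variable {n : ℕ} {f g : EuclideanSpace ℝ (Fin n) → ℝ}

lemma ContDiff.pd (hf : ContDiff ℝ (⊤ : ℕ∞) f) (i : Fin n) : ContDiff ℝ (⊤ : ℕ∞) (pd i f) :=
  (hf.fderiv_right (m := (⊤ : ℕ∞)) (by simp)).clm_apply contDiff_const

lemma ZnPeriodic.pd (hf : ZnPeriodic f) (i : Fin n) : ZnPeriodic (pd i f) := by
  intro x k
  unfold _root_.pd
  rw [← fderiv_comp_add_right]
  congr 2
  funext y
  exact hf y k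

lemma pd_comm (hf : ContDiff ℝ (⊤ : ℕ∞) f) (i j : Fin n) : pd i (pd j f) = pd j (pd i f) := by
  funext x
  have hd : DifferentiableAt ℝ (fderiv ℝ f) x :=
    ((hf.fderiv_right (m := (⊤ : ℕ∞)) (by simp)).differentiable (by simp)) x
  have key : ∀ a b : Fin n, pd a (pd b f) x =
      fderiv ℝ (fderiv ℝ f) x (EuclideanSpace.single a 1) (EuclideanSpace.single b 1) := by
    intro a b
    have : pd b f = fun y => fderiv ℝ f y (EuclideanSpace.single b 1) := rfl
    rw [this, pd, fderiv_clm_apply hd (differentiableAt_const _)]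
    simp
  rw [key, key]
  exact (hf.contDiffAt.isSymmSndFDerivAt (by simpa using WithTop.coe_le_coe.2 (le_top : (2 : ℕ∞) ≤ ⊤))).eq _ _

lemma pd_mul (hf : ContDiff ℝ (⊤ : ℕ∞) f) (hg : ContDiff ℝ (⊤ : ℕ∞) g) (i : Fin n)
    (x : EuclideanSpace ℝ (Fin n)) :
    pd i (fun y => f y * g y) x = f x * pd i g x + g x * pd i f x := by
  unfold pd
  rw [fderiv_fun_mul (hf.differentiable (by simp) x) (hg.differentiable (by simp) x)]
  simp

lemma pd_sum {ι : Type*} (s : Finset ι) {F : ι → EuclideanSpace ℝ (Fin n) → ℝ}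
    (hF : ∀ j, ContDiff ℝ (⊤ : ℕ∞) (F j)) (i : Fin n) (x : EuclideanSpace ℝ (Fin n)) :
    pd i (fun y => ∑ j ∈ s, F j y) x = ∑ j ∈ s, pd i (F j) x := by
  unfold pd
  rw [fderiv_fun_sum fun j _ => (hF j).differentiable (by simp) x]
  simp

lemma pd_comp {h : ℝ → ℝ} (hf : ContDiff ℝ (⊤ : ℕ∞) f) (i : Fin n)
    (x : EuclideanSpace ℝ (Fin n)) {h' : ℝ} (hh : HasDerivAt h h' (f x)) :
    pd i (fun y => h (f y)) x = h' * pd i f x := by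
  unfold pd
  have := hh.comp_hasFDerivAt x (hf.differentiable (by simp) x).hasFDerivAt
  have h2 : fderiv ℝ (fun y => h (f y)) x = _ := this.fderiv
  rw [h2]; simp

lemma sum_sq_pd_eq_norm_gradient_sq (f : EuclideanSpace ℝ (Fin n) → ℝ)
    (x : EuclideanSpace ℝ (Fin n)) : ∑ i, pd i f x ^ 2 = ‖gradient f x‖ ^ 2 := by
  rw [EuclideanSpace.norm_sq_eq]
  refine Finset.sum_congr rfl fun i _ => ?_
  have : pd i f x = gradient f x i := by
    unfold pd
    rw [← toDual_gradient, InnerProductSpace.toDual_apply_apply,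
      EuclideanSpace.inner_single_right]
    simp
  rw [this, Real.norm_eq_abs, sq_abs]

end Calculus

section Torus

variable {n : ℕ}

lemma fund_eq_preimage (n : ℕ) :
    fund n = (WithLp.ofLp : EuclideanSpace ℝ (Fin n) → Fin n → ℝ) ⁻¹'
      (Set.univ.pi fun _ => Ico (0 : ℝ) 1) := by
  ext x; simp [fund]

lemma measurableSet_fund (n : ℕ) : MeasurableSet (fund n) := by
  rw [fund_eq_preimage]
  exact (MeasurableSet.univ_pi fun _ => measurableSet_Ico).preimage
    (PiLp.volume_preserving_ofLp (Fin n)).measurable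

lemma fund_subset_isCompact (n : ℕ) : ∃ K, IsCompact K ∧ fund n ⊆ K := by
  refine ⟨(WithLp.ofLp : EuclideanSpace ℝ (Fin n) → Fin n → ℝ) ⁻¹'
    (Set.univ.pi fun _ => Icc (0 : ℝ) 1), ?_, ?_⟩
  · exact (EuclideanSpace.equiv (Fin n) ℝ).toHomeomorph.isCompact_preimage.2
      (isCompact_univ_pi fun _ => isCompact_Icc)
  · rw [fund_eq_preimage]
    exact preimage_mono (pi_mono fun _ _ => Ico_subset_Icc_self)

lemma Continuous.integrableOn_fund {f : EuclideanSpace ℝ (Fin n) → ℝ} (hf : Continuous f) :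
    IntegrableOn f (fund n) := by
  obtain ⟨K, hK, hs⟩ := fund_subset_isCompact n
  exact (hf.continuousOn.integrableOn_compact hK).mono_set hs

/-- The divergence theorem on the flat torus. -/
lemma integral_fund_sum_pd_eq_zero (V : Fin n → EuclideanSpace ℝ (Fin n) → ℝ)
    (hV : ∀ i, ContDiff ℝ (⊤ : ℕ∞) (V i)) (hp : ∀ i, ZnPeriodic (V i)) :
    ∫ x in fund n, ∑ i, pd i (V i) x = 0 := by
  cases n with
  | zero => simp
  | succ m =>
    let eL := (EuclideanSpace.equiv (Fin (m + 1)) ℝ).symm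
    have hmp : MeasurePreserving eL volume volume := PiLp.volume_preserving_toLp (Fin (m + 1))
    have hemb : MeasurableEmbedding eL := eL.toHomeomorph.measurableEmbedding
    have hpre : eL ⁻¹' fund (m + 1) = Set.univ.pi fun _ => Ico (0 : ℝ) 1 := by
      rw [fund_eq_preimage]; ext x; simp [eL]
    rw [← hmp.setIntegral_preimage_emb hemb, hpre, volume_pi]
    have hae := Measure.univ_pi_Ico_ae_eq_Icc (μ := fun _ : Fin (m + 1) => (volume : Measure ℝ))
      (f := fun _ => 0) (g := fun _ => 1)
    rw [setIntegral_congr_set hae, ← volume_pi]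
    have hcont : Continuous fun x : Fin (m + 1) → ℝ => ∑ i, pd i (V i) (eL x) :=
      continuous_finsetSum _ fun i _ => ((hV i).pd i).continuous.comp eL.continuous
    have key := integral_divergence_of_hasFDerivAt_off_countable' (E := ℝ)
      (fun _ : Fin (m + 1) => (0 : ℝ)) (fun _ => 1) (fun _ => zero_le_one)
      (fun i x => V i (eL x))
      (fun i x => (fderiv ℝ (V i) (eL x)).comp (eL : (Fin (m + 1) → ℝ) →L[ℝ] _))
      ∅ countable_empty (fun i => ((hV i).continuous.comp eL.continuous).continuousOn)
      (fun x _ i => ((hV i).differentiable (by simp) (eL x)).hasFDerivAt.comp x eL.hasFDerivAt)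
      (by
        refine hcont.continuousOn.integrableOn_compact ?_
        exact isCompact_Icc)
    have e1 : ∀ i : Fin (m + 1), eL (Pi.single i 1) = EuclideanSpace.single i 1 := fun i => rfl
    simp only [ContinuousLinearMap.comp_apply, ContinuousLinearEquiv.coe_coe, e1] at key
    refine key.trans (Finset.sum_eq_zero fun i _ => ?_)
    rw [sub_eq_zero]
    congr 1
    funext y
    have := hp i (eL (i.insertNth 0 y)) (Pi.single i 1)
    rw [← this]
    congr 1
    ext j
    refine Fin.succAboveCases i ?_ (fun j => ?_) j
    · simp [eL]
    · simp [eL]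

lemma volume_fund (n : ℕ) : volume (fund n) = 1 := by
  rw [fund_eq_preimage, (PiLp.volume_preserving_ofLp (Fin n)).measure_preimage
    (MeasurableSet.univ_pi fun _ => measurableSet_Ico).nullMeasurableSet, volume_pi_pi]
  simp

end Torus

section Energy

variable {n : ℕ} {lam : ℝ} {φ : EuclideanSpace ℝ (Fin n) → ℝ}

lemma integral_sum_sq_pd (hφ : ContDiff ℝ (⊤ : ℕ∞) φ) (hp : ZnPeriodic φ)
    (hl : ∀ x, ∑ i, pd i (pd i φ) x = -lam ^ 2 * φ x) :
    ∫ x in fund n, ∑ i, pd i φ x ^ 2 = lam ^ 2 * ∫ x in fund n, φ x ^ 2 := by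
  have h0 := integral_fund_sum_pd_eq_zero (fun i y => φ y * pd i φ y)
    (fun i => hφ.mul (hφ.pd i)) (fun i x k => by simp only [hp x k, hp.pd i x k])
  have h1 : ∀ x, ∑ i, pd i (fun y => φ y * pd i φ y) x =
      ∑ i, pd i φ x ^ 2 - lam ^ 2 * φ x ^ 2 := by
    intro x
    simp only [pd_mul hφ (hφ.pd _), Finset.sum_add_distrib, ← Finset.mul_sum, hl, ← sq]
    ring
  have hc1 : Continuous fun x => ∑ i, pd i φ x ^ 2 :=
    continuous_finsetSum _ fun i _ => (hφ.pd i).continuous.pow 2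
  have hc2 : Continuous fun x => lam ^ 2 * φ x ^ 2 :=
    continuous_const.mul (hφ.continuous.pow 2)
  simp only [h1] at h0
  rw [integral_sub hc1.integrableOn_fund hc2.integrableOn_fund, integral_const_mul] at h0
  linarith

lemma integral_sum_sq_pd_pd (hφ : ContDiff ℝ (⊤ : ℕ∞) φ) (hp : ZnPeriodic φ)
    (hl : ∀ x, ∑ i, pd i (pd i φ) x = -lam ^ 2 * φ x) :
    ∫ x in fund n, ∑ j, ∑ i, pd i (pd j φ) x ^ 2 = lam ^ 4 * ∫ x in fund n, φ x ^ 2 := by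
  have hl' : ∀ j x, ∑ i, pd i (pd i (pd j φ)) x = -lam ^ 2 * pd j φ x := by
    intro j x
    have e1 : ∀ i, pd i (pd i (pd j φ)) = pd j (pd i (pd i φ)) := fun i => by
      rw [pd_comm hφ i j, pd_comm (hφ.pd i) i j]
    have e2 : (fun y => ∑ i, pd i (pd i φ) y) = fun y => -lam ^ 2 * φ y := funext hl
    have e3 := congrArg (fun F => pd j F x) e2
    simp only [pd_sum _ fun i => (hφ.pd i).pd i] at e3
    simp only [e1, e3]
    have := pd_comp hφ j x ((hasDerivAt_id (φ x)).const_mul (-lam ^ 2))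
    simpa using this
  rw [integral_finsetSum]
  · simp only [fun j => integral_sum_sq_pd (hφ.pd j) (hp.pd j) (hl' j)]
    rw [← Finset.mul_sum, ← integral_finsetSum, integral_sum_sq_pd hφ hp hl]
    · ring
    · exact fun i _ => ((hφ.pd i).continuous.pow 2).integrableOn_fund
  · exact fun j _ => (continuous_finsetSum _ fun i _ =>
      ((hφ.pd j).pd i).continuous.pow 2).integrableOn_fund

lemma abs_arctan_le_two (t : ℝ) : |Real.arctan t| ≤ 2 := by
  rw [abs_le]
  constructor <;> linarith [Real.neg_pi_div_two_lt_arctan t, Real.arctan_lt_pi_div_two t,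
    Real.pi_le_four]

/-- Pointwise bound for the lower order terms in the divergence of
`√(|∇φ|² + λ²) h(φ) ∇φ`, with `a = ∇φ` and `A = ∇²φ` at a point. -/
lemma abs_lower_order_le {lam s h p : ℝ} (hl : 0 < lam) (hh : |h| ≤ 2) (a : Fin n → ℝ)
    (A : Fin n → Fin n → ℝ) (hs : 0 < s) (hs2 : s ^ 2 = ∑ i, a i ^ 2 + lam ^ 2) :
    |s * (h * (lam ^ 2 * p)) - h * ∑ i, a i * ((∑ j, a j * A j i) / s)| ≤
      2 * lam * ∑ i, a i ^ 2 + lam ^ 3 + lam ^ 3 * p ^ 2 + (∑ j, ∑ i, A j i ^ 2) / lam := by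
  have t1 : |s * (h * (lam ^ 2 * p))| ≤ lam * s ^ 2 + lam ^ 3 * p ^ 2 := by
    have e : |s * (h * (lam ^ 2 * p))| = |h| * (lam ^ 2 * (s * |p|)) := by
      rw [abs_mul, abs_mul, abs_mul, abs_of_pos hs, abs_of_pos (by positivity : 0 < lam ^ 2)]
      ring
    rw [e]
    calc |h| * (lam ^ 2 * (s * |p|)) ≤ 2 * (lam ^ 2 * (s * |p|)) := by gcongr
      _ ≤ lam * s ^ 2 + lam ^ 3 * |p| ^ 2 := by
          nlinarith [mul_nonneg hl.le (sq_nonneg (s - lam * |p|))]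
      _ = _ := by rw [sq_abs]
  have t2 : |h * ∑ i, a i * ((∑ j, a j * A j i) / s)| ≤
      (∑ j, ∑ i, A j i ^ 2) / lam + lam * ∑ i, a i ^ 2 := by
    have hq : (∑ i, a i ^ 2) / s ^ 2 ≤ 1 := by
      rw [div_le_one (by positivity), hs2]; nlinarith
    have e : ∑ i, a i * ((∑ j, a j * A j i) / s) = ∑ j, ∑ i, A j i * (a j * a i / s) := by
      rw [Finset.sum_comm]
      refine Finset.sum_congr rfl fun i _ => ?_
      rw [Finset.sum_div, Finset.mul_sum]
      exact Finset.sum_congr rfl fun j _ => by ring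
    rw [e, abs_mul]
    calc |h| * |∑ j, ∑ i, A j i * (a j * a i / s)|
        ≤ 2 * ∑ j, ∑ i, |A j i * (a j * a i / s)| := by
          gcongr
          exact (Finset.abs_sum_le_sum_abs _ _).trans
            (Finset.sum_le_sum fun j _ => Finset.abs_sum_le_sum_abs _ _)
      _ = ∑ j, ∑ i, 2 * |A j i * (a j * a i / s)| := by simp only [Finset.mul_sum]
      _ ≤ ∑ j, ∑ i, (A j i ^ 2 / lam + lam * (a j ^ 2 * a i ^ 2 / s ^ 2)) := by
          refine Finset.sum_le_sum fun j _ => Finset.sum_le_sum fun i _ => ?_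
          set q := a j * a i / s with hqd
          have : a j ^ 2 * a i ^ 2 / s ^ 2 = q ^ 2 := by rw [hqd]; ring
          rw [this, abs_mul, ← sq_abs (A j i), ← sq_abs q, div_add' _ _ _ hl.ne', le_div_iff₀ hl]
          nlinarith [sq_nonneg (|A j i| - lam * |q|)]
      _ = (∑ j, ∑ i, A j i ^ 2) / lam + lam * ((∑ i, a i ^ 2) * ((∑ i, a i ^ 2) / s ^ 2)) := by
          simp only [Finset.sum_add_distrib, Finset.sum_div, Finset.mul_sum, Finset.sum_mul]
          congr 1
          refine Finset.sum_congr rfl fun j _ => Finset.sum_congr rfl fun i _ => ?_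
          ring
      _ ≤ _ := by
          gcongr
          exact mul_le_of_le_one_right (Finset.sum_nonneg fun i _ => sq_nonneg _) hq
  refine (abs_sub _ _).trans ((add_le_add t1 t2).trans (le_of_eq ?_))
  rw [hs2]; ring

lemma integral_weighted_gradient_le (hlam : 0 < lam) (hφ : ContDiff ℝ (⊤ : ℕ∞) φ)
    (hp : ZnPeriodic φ) (hl : ∀ x, ∑ i, pd i (pd i φ) x = -lam ^ 2 * φ x)
    (hn : ∫ x in fund n, φ x ^ 2 = 1) (ε : ℝ) :
    ∫ x in fund n, √(∑ i, pd i φ x ^ 2 + lam ^ 2) * (∑ i, pd i φ x ^ 2) *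
      (1 / (1 + (φ x / ε) ^ 2) * (1 / ε)) ≤ 5 * lam ^ 3 := by
  set G : EuclideanSpace ℝ (Fin n) → ℝ := fun x => ∑ i, pd i φ x ^ 2 with hG
  set H : EuclideanSpace ℝ (Fin n) → ℝ := fun x => ∑ j, ∑ i, pd i (pd j φ) x ^ 2 with hH
  set s : EuclideanSpace ℝ (Fin n) → ℝ := fun x => √(G x + lam ^ 2) with hs
  set h : EuclideanSpace ℝ (Fin n) → ℝ := fun x => Real.arctan (φ x / ε) with hh
  have hGpos : ∀ x, 0 < G x + lam ^ 2 := fun x =>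
    add_pos_of_nonneg_of_pos (Finset.sum_nonneg fun i _ => sq_nonneg _) (by positivity)
  have hGs : ContDiff ℝ (⊤ : ℕ∞) G := ContDiff.sum fun i _ => (hφ.pd i).pow 2
  have hHc : Continuous H := continuous_finsetSum _ fun j _ => continuous_finsetSum _ fun i _ =>
    ((hφ.pd j).pd i).continuous.pow 2
  have hss : ContDiff ℝ (⊤ : ℕ∞) s := (hGs.add contDiff_const).sqrt fun x => (hGpos x).ne'
  have hhs : ContDiff ℝ (⊤ : ℕ∞) h := (hφ.div_const ε).arctan
  have hGp : ZnPeriodic G := fun x k => by simp only [hG, hp.pd _ x k]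
  have hspos : ∀ x, 0 < s x := fun x => Real.sqrt_pos.2 (hGpos x)
  have hpdh : ∀ i x, pd i h x = 1 / (1 + (φ x / ε) ^ 2) * (1 / ε) * pd i φ x := fun i x =>
    pd_comp (h := fun t => Real.arctan (t / ε)) hφ i x
      (((hasDerivAt_id _).div_const ε).arctan)
  have hpds : ∀ i x, pd i s x = (∑ j, pd j φ x * pd i (pd j φ) x) / s x := fun i x => by
    have e1 := pd_comp (h := fun t => √(t + lam ^ 2)) hGs i x
      (((hasDerivAt_id _).add_const (lam ^ 2)).sqrt (hGpos x).ne')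
    have e2 : pd i G x = 2 * ∑ j, pd j φ x * pd i (pd j φ) x := by
      have : pd i G x = ∑ j, pd i (fun y => pd j φ y * pd j φ y) x := by
        simp only [hG, sq]
        exact pd_sum _ (fun j => (hφ.pd j).mul (hφ.pd j)) i x
      rw [this, Finset.mul_sum]
      refine Finset.sum_congr rfl fun j _ => ?_
      rw [pd_mul (hφ.pd j) (hφ.pd j)]; ring
    have e3 : pd i s x = _ := e1
    rw [e3, e2]
    have : s x ≠ 0 := (hspos x).ne'
    change 1 / (2 * s x) * _ = _
    field_simp
  have h0 := integral_fund_sum_pd_eq_zero (fun i y => s y * (h y * pd i φ y))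
    (fun i => hss.mul (hhs.mul (hφ.pd i)))
    (fun i x k => by simp only [hs, hh, hGp x k, hp x k, hp.pd i x k])
  have h1 : ∀ x, ∑ i, pd i (fun y => s y * (h y * pd i φ y)) x =
      s x * G x * (1 / (1 + (φ x / ε) ^ 2) * (1 / ε)) - (s x * (h x * (lam ^ 2 * φ x)) -
        h x * ∑ i, pd i φ x * ((∑ j, pd j φ x * pd i (pd j φ) x) / s x)) := by
    intro x
    have e : ∀ i, pd i (fun y => s y * (h y * pd i φ y)) x =
        s x * h x * pd i (pd i φ) x +
        s x * (1 / (1 + (φ x / ε) ^ 2) * (1 / ε)) * pd i φ x ^ 2 +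
        h x * (pd i φ x * ((∑ j, pd j φ x * pd i (pd j φ) x) / s x)) := by
      intro i
      rw [pd_mul hss (hhs.mul (hφ.pd i)), pd_mul hhs (hφ.pd i), hpdh, hpds]
      ring
    simp only [e, Finset.sum_add_distrib, ← Finset.mul_sum, hl, hG]
    ring
  set F : EuclideanSpace ℝ (Fin n) → ℝ := fun x =>
    s x * G x * (1 / (1 + (φ x / ε) ^ 2) * (1 / ε)) with hF
  have hFc : Continuous F := by
    have : Continuous fun x => 1 / (1 + (φ x / ε) ^ 2) :=
      continuous_const.div (continuous_const.add ((hφ.continuous.div_const ε).pow 2))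
        fun x => by positivity
    exact (hss.continuous.mul hGs.continuous).mul (this.mul continuous_const)
  have hdivc : Continuous fun x => ∑ i, pd i (fun y => s y * (h y * pd i φ y)) x :=
    continuous_finsetSum _ fun i _ => ((hss.mul (hhs.mul (hφ.pd i))).pd i).continuous
  have hcG : Continuous fun x => 2 * lam * G x := continuous_const.mul hGs.continuous
  have hcφ : Continuous fun x => lam ^ 3 * φ x ^ 2 :=
    continuous_const.mul (hφ.continuous.pow 2)
  have hcH : Continuous fun x => H x / lam := hHc.div_const lam
  have hcK : Continuous fun _ : EuclideanSpace ℝ (Fin n) => lam ^ 3 := continuous_const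
  have hc2 : Continuous fun x => 2 * lam * G x + lam ^ 3 := hcG.add hcK
  have hc3 : Continuous fun x => 2 * lam * G x + lam ^ 3 + lam ^ 3 * φ x ^ 2 := hc2.add hcφ
  have hc4 : Continuous fun x => 2 * lam * G x + lam ^ 3 + lam ^ 3 * φ x ^ 2 + H x / lam :=
    hc3.add hcH
  have hle : ∫ x in fund n, F x ≤ ∫ x in fund n, ((∑ i, pd i (fun y => s y * (h y * pd i φ y)) x) +
      (2 * lam * G x + lam ^ 3 + lam ^ 3 * φ x ^ 2 + H x / lam)) := by
    refine integral_mono hFc.integrableOn_fund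
      (hdivc.add hc4).integrableOn_fund fun x => ?_
    have := (abs_le.1 (abs_lower_order_le (p := φ x) hlam (abs_arctan_le_two (φ x / ε))
      (fun i => pd i φ x) (fun j i => pd i (pd j φ) x) (hspos x)
      (Real.sq_sqrt (hGpos x).le))).2
    simp only [h1]
    linarith
  refine hle.trans (le_of_eq ?_)
  rw [integral_add hdivc.integrableOn_fund hc4.integrableOn_fund,
    integral_add hc3.integrableOn_fund hcH.integrableOn_fund,
    integral_add hc2.integrableOn_fund hcφ.integrableOn_fund,
    integral_add hcG.integrableOn_fund hcK.integrableOn_fund, h0, integral_const_mul,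
    integral_const_mul, integral_div, integral_sum_sq_pd hφ hp hl, hn,
    integral_sum_sq_pd_pd hφ hp hl, hn]
  simp only [setIntegral_const, measureReal_def, volume_fund]
  simp only [ENNReal.toReal_one, smul_eq_mul]
  field_simp
  ring

/-- Uniform bound for the mass of `|∇φ|³` on thin neighbourhoods of the nodal set. -/
lemma lintegral_gradient_cube_le (hlam : 0 < lam) (hφ : IsTorusEigenfunction lam φ)
    (hn : ∫ x in fund n, φ x ^ 2 = 1) {ε : ℝ} (hε : 0 < ε) :
    ∫⁻ x in fund n ∩ {x | |φ x| ≤ ε}, ENNReal.ofReal (‖gradient φ x‖ ^ 3 / ε) ≤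
      ENNReal.ofReal (10 * lam ^ 3) := by
  obtain ⟨hs, hp, -, hl⟩ := hφ
  have hb := integral_weighted_gradient_le hlam hs hp hl hn ε
  set F : EuclideanSpace ℝ (Fin n) → ℝ := fun x => √(∑ i, pd i φ x ^ 2 + lam ^ 2) *
    (∑ i, pd i φ x ^ 2) * (1 / (1 + (φ x / ε) ^ 2) * (1 / ε)) with hF
  have hGc : Continuous fun x => ∑ i, pd i φ x ^ 2 :=
    continuous_finsetSum _ fun i _ => (hs.pd i).continuous.pow 2
  have hFc : Continuous F := by
    have : Continuous fun x => 1 / (1 + (φ x / ε) ^ 2) :=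
      continuous_const.div (continuous_const.add ((hs.continuous.div_const ε).pow 2))
        fun x => by positivity
    exact ((hGc.add continuous_const).sqrt.mul hGc).mul (this.mul continuous_const)
  have hF0 : ∀ x, 0 ≤ F x := fun x => by
    have : 0 ≤ ∑ i, pd i φ x ^ 2 := Finset.sum_nonneg fun i _ => sq_nonneg _
    simp only [hF]; positivity
  calc ∫⁻ x in fund n ∩ {x | |φ x| ≤ ε}, ENNReal.ofReal (‖gradient φ x‖ ^ 3 / ε)
      ≤ ∫⁻ x in fund n ∩ {x | |φ x| ≤ ε}, ENNReal.ofReal (2 * F x) := by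
        refine setLIntegral_mono' ((measurableSet_fund n).inter
          (measurableSet_le hs.continuous.abs.measurable measurable_const)) fun x hx => ?_
        refine ENNReal.ofReal_le_ofReal ?_
        simp only [hF, sum_sq_pd_eq_norm_gradient_sq]
        set u := ‖gradient φ x‖
        have hu : 0 ≤ u := norm_nonneg _
        have h1 : u ≤ √(u ^ 2 + lam ^ 2) := Real.le_sqrt_of_sq_le (by nlinarith)
        have h2 : (φ x / ε) ^ 2 ≤ 1 := by
          rw [sq_le_one_iff_abs_le_one, abs_div, abs_of_pos hε, div_le_one hε]
          exact hx.2
        have h3 : 1 / 2 ≤ 1 / (1 + (φ x / ε) ^ 2) :=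
          one_div_le_one_div_of_le (by positivity) (by linarith)
        calc u ^ 3 / ε = 2 * (u * u ^ 2 * (1 / 2 * (1 / ε))) := by ring
          _ ≤ _ := by gcongr
    _ ≤ ∫⁻ x in fund n, ENNReal.ofReal (2 * F x) := lintegral_mono_set inter_subset_left
    _ = ENNReal.ofReal (∫ x in fund n, 2 * F x) :=
        (ofReal_integral_eq_lintegral_ofReal (hFc.const_mul 2).integrableOn_fund
          (Eventually.of_forall fun x => by have := hF0 x; simp only [Pi.zero_apply]; positivity)).symm
    _ ≤ _ := by
        refine ENNReal.ofReal_le_ofReal ?_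
        rw [integral_const_mul]
        linarith

end Energy

section Covering

variable {n : ℕ}

/-- The half-open cell with index `j` of the grid of mesh `1 / N` in the unit cube. -/
def gridCell (N : ℕ) (j : Fin n → Fin N) : Set (EuclideanSpace ℝ (Fin n)) :=
  {x | ∀ i, x i ∈ Ico ((j i : ℝ) / N) (((j i : ℝ) + 1) / N)}

lemma gridCell_eq_preimage (N : ℕ) (j : Fin n → Fin N) :
    gridCell N j = (WithLp.ofLp : EuclideanSpace ℝ (Fin n) → Fin n → ℝ) ⁻¹'
      (Set.univ.pi fun i => Ico ((j i : ℝ) / N) (((j i : ℝ) + 1) / N)) := by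
  ext x; simp [gridCell]

lemma measurableSet_gridCell (N : ℕ) (j : Fin n → Fin N) : MeasurableSet (gridCell N j) := by
  rw [gridCell_eq_preimage]
  exact (MeasurableSet.univ_pi fun _ => measurableSet_Ico).preimage
    (PiLp.volume_preserving_ofLp (Fin n)).measurable

lemma volume_gridCell (N : ℕ) (j : Fin n → Fin N) :
    volume (gridCell N j) = ENNReal.ofReal ((1 / N : ℝ) ^ n) := by
  rw [gridCell_eq_preimage, (PiLp.volume_preserving_ofLp (Fin n)).measure_preimage
    (MeasurableSet.univ_pi fun _ => measurableSet_Ico).nullMeasurableSet, volume_pi_pi,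
    ENNReal.ofReal_pow (by positivity)]
  simp [← sub_div]

lemma gridCell_subset_fund (N : ℕ) (j : Fin n → Fin N) : gridCell N j ⊆ fund n := by
  intro x hx i
  have hN : (0 : ℝ) < N := by exact_mod_cast (j i).pos
  refine ⟨le_trans (by positivity) (hx i).1, (hx i).2.trans_le ?_⟩
  rw [div_le_one hN]
  exact_mod_cast (j i).isLt

lemma fund_subset_iUnion_gridCell {N : ℕ} (hN : 0 < N) :
    fund n ⊆ ⋃ j : Fin n → Fin N, gridCell N j := by
  intro x hx
  have hN' : (0 : ℝ) < N := by exact_mod_cast hN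
  have h0 : ∀ i, 0 ≤ x i * N := fun i => mul_nonneg (hx i).1 hN'.le
  refine mem_iUnion.2 ⟨fun i => ⟨⌊x i * N⌋₊, ?_⟩, fun i => ⟨?_, ?_⟩⟩
  · rw [Nat.floor_lt (h0 i)]
    nlinarith [(hx i).2]
  · rw [div_le_iff₀ hN']
    exact Nat.floor_le (h0 i)
  · rw [lt_div_iff₀ hN']
    exact Nat.lt_floor_add_one _

lemma pairwise_disjoint_gridCell (N : ℕ) :
    Pairwise (Function.onFun Disjoint (gridCell N : (Fin n → Fin N) → _)) := by
  intro j l hjl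
  rw [Function.onFun, Set.disjoint_left]
  intro x hx hy
  refine hjl (funext fun i => ?_)
  have hN : (0 : ℝ) < N := by exact_mod_cast (j i).pos
  have h1 := hx i
  have h2 := hy i
  rw [mem_Ico, div_le_iff₀ hN, lt_div_iff₀ hN] at h1 h2
  have e1 : (j i : ℝ) < (l i : ℝ) + 1 := h1.1.trans_lt h2.2
  have e2 : (l i : ℝ) < (j i : ℝ) + 1 := h2.1.trans_lt h1.2
  have e1' : (j i : ℕ) < (l i : ℕ) + 1 := by exact_mod_cast e1
  have e2' : (l i : ℕ) < (j i : ℕ) + 1 := by exact_mod_cast e2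
  exact Fin.ext (by omega)

lemma dist_le_of_mem_gridCell {N : ℕ} {j : Fin n → Fin N} {x y : EuclideanSpace ℝ (Fin n)}
    (hx : x ∈ gridCell N j) (hy : y ∈ gridCell N j) : dist x y ≤ n / N := by
  rw [EuclideanSpace.dist_eq]
  refine Real.sqrt_le_iff.2 ⟨by positivity, ?_⟩
  have : ∀ i ∈ Finset.univ, dist (x i) (y i) ^ 2 ≤ (1 / N : ℝ) ^ 2 := by
    intro i _
    gcongr
    have h1 := hx i
    have h2 := hy i
    rw [mem_Ico, add_div] at h1 h2
    rw [Real.dist_eq, abs_le]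
    constructor <;> linarith
  refine (Finset.sum_le_sum this).trans ?_
  have hn : (n : ℝ) ≤ (n : ℝ) ^ 2 := by exact_mod_cast Nat.le_self_pow two_ne_zero n
  rw [Finset.sum_const, Finset.card_univ, Fintype.card_fin, nsmul_eq_mul, div_pow, div_pow,
    one_pow, mul_one_div]
  gcongr

lemma convex_gridCell (N : ℕ) (j : Fin n → Fin N) : Convex ℝ (gridCell N j) := by
  intro x hx y hy s t hs ht hst i
  exact convex_Ico _ _ (hx i) (hy i) hs ht hst

lemma ediam_gridCell_le (N : ℕ) (j : Fin n → Fin N) :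
    Metric.ediam (gridCell N j) ≤ ENNReal.ofReal (n / N) := by
  refine Metric.ediam_le fun x hx y hy => ?_
  rw [edist_dist]
  exact ENNReal.ofReal_le_ofReal (dist_le_of_mem_gridCell hx hy)

variable {φ : EuclideanSpace ℝ (Fin n) → ℝ}

lemma norm_gradient_eq_norm_fderiv (φ : EuclideanSpace ℝ (Fin n) → ℝ)
    (x : EuclideanSpace ℝ (Fin n)) : ‖gradient φ x‖ = ‖fderiv ℝ φ x‖ := by
  rw [← toDual_gradient, LinearIsometryEquiv.norm_map]

lemma ContDiff.continuous_norm_gradient (hφ : ContDiff ℝ (⊤ : ℕ∞) φ) :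
    Continuous fun x => ‖gradient φ x‖ := by
  simp only [norm_gradient_eq_norm_fderiv]
  exact (hφ.continuous_fderiv (by simp)).norm

lemma gridCell_subset_of_mem (hφ : Differentiable ℝ φ) {a : ℝ} (ha : 0 < a) {N : ℕ}
    {j : Fin n → Fin N} {x : EuclideanSpace ℝ (Fin n)} (hx : x ∈ gridCell N j) (hx0 : φ x = 0)
    (hxa : ‖gradient φ x‖ ∈ Ioc a (2 * a))
    (hosc : ∀ y ∈ gridCell N j, dist ‖gradient φ x‖ ‖gradient φ y‖ < a / 2) :
    gridCell N j ⊆ fund n ∩ {y | |φ y| ≤ 4 * a * (n / N)} ∩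
      {y | ‖gradient φ y‖ ∈ Ioc (a / 2) (4 * a)} := by
  have hb : ∀ y ∈ gridCell N j, ‖gradient φ y‖ ∈ Ioc (a / 2) (4 * a) := by
    intro y hy
    have := abs_lt.1 (hosc y hy)
    constructor <;> linarith [hxa.1, hxa.2]
  refine fun y hy => ⟨⟨gridCell_subset_fund N j hy, ?_⟩, hb y hy⟩
  have h := (convex_gridCell N j).norm_image_sub_le_of_norm_fderiv_le (f := φ) (𝕜 := ℝ)
    (C := 4 * a) (fun z _ => hφ z)
    (fun z hz => (norm_gradient_eq_norm_fderiv φ z).symm.trans_le (hb z hz).2) hx hy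
  rw [hx0, sub_zero, ← dist_eq_norm] at h
  exact h.trans (by gcongr; exact dist_le_of_mem_gridCell hy hx)

/-- The `(n-1)`-dimensional content of the cells of a fine grid that meet a level of the nodal set
on which the gradient has size comparable to `a`. -/
lemma sum_ediam_rpow_le (hn : 2 ≤ n) (hφ : ContDiff ℝ (⊤ : ℕ∞) φ) {a : ℝ} (ha : 0 < a) {N : ℕ}
    (hN : 0 < N) {B : Set (EuclideanSpace ℝ (Fin n))} {J : Set (Fin n → Fin N)}
    [DecidablePred (· ∈ J)]
    (hJ : ∀ j ∈ J, gridCell N j ⊆ B)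
    (hB : ∀ x ∈ B, a / 2 ≤ ‖gradient φ x‖) :
    ENNReal.ofReal (4 * a ^ 2) *
        ∑ j, Metric.ediam (if j ∈ J then gridCell N j else ∅) ^ ((n : ℝ) - 1) ≤
      ENNReal.ofReal (128 * n ^ n) *
        ∫⁻ x in B, ENNReal.ofReal (‖gradient φ x‖ ^ 3 / (4 * a * (n / N))) := by
  have hN' : (0 : ℝ) < N := by exact_mod_cast hN
  have hn' : (0 : ℝ) < n := by exact_mod_cast (by omega : 0 < n)
  have hd : (1 : ℝ) < n := by exact_mod_cast hn
  set f : EuclideanSpace ℝ (Fin n) → ℝ≥0∞ :=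
    fun x => ENNReal.ofReal (‖gradient φ x‖ ^ 3 / (4 * a * (n / N))) with hf
  have hcell : ∀ j, ENNReal.ofReal (4 * a ^ 2) *
      Metric.ediam (if j ∈ J then gridCell N j else ∅) ^ ((n : ℝ) - 1) ≤
      ENNReal.ofReal (128 * n ^ n) * ∫⁻ x in gridCell N j ∩ B, f x := by
    intro j
    by_cases hj : j ∈ J
    · rw [if_pos hj, inter_eq_left.2 (hJ j hj)]
      have h1 : Metric.ediam (gridCell N j) ^ ((n : ℝ) - 1) ≤
          ENNReal.ofReal ((n / N : ℝ) ^ (n - 1)) := by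
        refine (ENNReal.rpow_le_rpow (ediam_gridCell_le N j) (by linarith)).trans (le_of_eq ?_)
        rw [ENNReal.ofReal_rpow_of_pos (by positivity), ← Real.rpow_natCast, Nat.cast_sub (by omega),
          Nat.cast_one]
      have h2 : ENNReal.ofReal ((a / 2) ^ 3 / (4 * a * (n / N))) *
          ENNReal.ofReal ((1 / N : ℝ) ^ n) ≤ ∫⁻ x in gridCell N j, f x := by
        rw [← volume_gridCell N j, ← setLIntegral_const]
        refine setLIntegral_mono' (measurableSet_gridCell N j) fun x hx => ?_
        refine ENNReal.ofReal_le_ofReal ?_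
        gcongr
        exact hB x (hJ j hj hx)
      refine (mul_le_mul_right h1 _).trans (le_trans (le_of_eq ?_) (mul_le_mul_right h2 _))
      rw [← ENNReal.ofReal_mul (by positivity), ← ENNReal.ofReal_mul (by positivity),
        ← ENNReal.ofReal_mul (by positivity)]
      congr 1
      obtain ⟨m, rfl⟩ : ∃ m, n = m + 1 := ⟨n - 1, by omega⟩
      simp only [Nat.add_sub_cancel, div_pow, one_pow, pow_succ]
      field_simp
      ring
    · rw [if_neg hj, Metric.ediam_empty, ENNReal.zero_rpow_of_pos (by linarith), mul_zero]
      exact zero_le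
  calc _ = ∑ j, ENNReal.ofReal (4 * a ^ 2) *
        Metric.ediam (if j ∈ J then gridCell N j else ∅) ^ ((n : ℝ) - 1) := by
        rw [Finset.mul_sum]
    _ ≤ ∑ j, ENNReal.ofReal (128 * n ^ n) * ∫⁻ x in gridCell N j ∩ B, f x :=
        Finset.sum_le_sum fun j _ => hcell j
    _ = ENNReal.ofReal (128 * n ^ n) * ∫⁻ x in B ∩ ⋃ j, gridCell N j, f x := by
        rw [← Finset.mul_sum]
        congr 1
        have : ∀ j, ∫⁻ x in gridCell N j ∩ B, f x =
            ∫⁻ x in gridCell N j, f x ∂(volume.restrict B) := fun j => by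
          rw [Measure.restrict_restrict (measurableSet_gridCell N j)]
        simp only [this]
        rw [← tsum_fintype (L := .unconditional _),
          ← lintegral_iUnion (measurableSet_gridCell N) (pairwise_disjoint_gridCell N),
          Measure.restrict_restrict (MeasurableSet.iUnion (measurableSet_gridCell N)), inter_comm]
    _ ≤ _ := by
        gcongr
        exact inter_subset_left

/-- On the part of the nodal set where the gradient has size comparable to `a`, the weighted
Hausdorff measure is controlled by the mass of `|∇φ|³` on thin neighbourhoods. -/
lemma lintegral_nodal_level_le (hn : 2 ≤ n) (hφ : ContDiff ℝ (⊤ : ℕ∞) φ) {a : ℝ} (ha : 0 < a)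
    {N : ℕ → ℕ} (hN : ∀ᶠ m in atTop, (N m : ℝ) = a * 2 ^ m) :
    ∫⁻ x in {x ∈ fund n | φ x = 0 ∧ ‖gradient φ x‖ ∈ Ioc a (2 * a)},
        ENNReal.ofReal (‖gradient φ x‖ ^ 2) ∂μH[(n : ℝ) - 1] ≤
      ENNReal.ofReal (128 * n ^ n) * liminf (fun m : ℕ =>
        ∫⁻ x in fund n ∩ {x | |φ x| ≤ 4 * n / 2 ^ m} ∩ {x | ‖gradient φ x‖ ∈ Ioc (a / 2) (4 * a)},
          ENNReal.ofReal (‖gradient φ x‖ ^ 3 / (4 * n / 2 ^ m))) atTop := by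
  classical
  have hu := hφ.continuous_norm_gradient
  set S := {x ∈ fund n | φ x = 0 ∧ ‖gradient φ x‖ ∈ Ioc a (2 * a)} with hS
  have hSm : MeasurableSet S := (measurableSet_fund n).inter
    ((measurableSet_eq_fun hφ.continuous.measurable measurable_const).inter
      (hu.measurable measurableSet_Ioc))
  obtain ⟨K, hK, hfK⟩ := fund_subset_isCompact n
  obtain ⟨δ, hδ, hosc⟩ := Metric.uniformContinuousOn_iff.1
    (hK.uniformContinuousOn_of_continuous hu.continuousOn) (a / 2) (by positivity)
  have hlim : Tendsto (fun m : ℕ => (n : ℝ) / (a * 2 ^ m)) atTop (𝓝 0) :=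
    tendsto_const_nhds.div_atTop
      ((tendsto_pow_atTop_atTop_of_one_lt one_lt_two).const_mul_atTop ha)
  have hr : Tendsto (fun m => ENNReal.ofReal (n / N m)) atTop (𝓝 0) := by
    rw [← ENNReal.ofReal_zero]
    refine ENNReal.tendsto_ofReal (hlim.congr' ?_)
    filter_upwards [hN] with m hm
    rw [hm]
  let J : ∀ m, Set (Fin n → Fin (N m)) := fun m => {j | (gridCell (N m) j ∩ S).Nonempty}
  have hN0 : ∀ᶠ m in atTop, 0 < N m := by
    filter_upwards [hN] with m hm
    have : (0 : ℝ) < N m := by rw [hm]; positivity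
    exact_mod_cast this
  have hH := Measure.hausdorffMeasure_le_liminf_sum ((n : ℝ) - 1) S _ hr
    (fun m j => if j ∈ J m then gridCell (N m) j else ∅)
    (Eventually.of_forall fun m j => by
      split_ifs
      · exact ediam_gridCell_le _ _
      · simp)
    (by
      filter_upwards [hN0] with m hm x hx
      obtain ⟨j, hj⟩ := mem_iUnion.1 (fund_subset_iUnion_gridCell hm hx.1)
      have : j ∈ J m := ⟨x, hj, hx⟩
      exact mem_iUnion.2 ⟨j, by rwa [if_pos this]⟩)
  calc ∫⁻ x in S, ENNReal.ofReal (‖gradient φ x‖ ^ 2) ∂μH[(n : ℝ) - 1]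
      ≤ ∫⁻ _ in S, ENNReal.ofReal (4 * a ^ 2) ∂μH[(n : ℝ) - 1] := by
        refine setLIntegral_mono' hSm fun x hx => ENNReal.ofReal_le_ofReal ?_
        calc ‖gradient φ x‖ ^ 2 ≤ (2 * a) ^ 2 := by gcongr; exact hx.2.2.2
          _ = _ := by ring
    _ = ENNReal.ofReal (4 * a ^ 2) * μH[(n : ℝ) - 1] S := setLIntegral_const _ _
    _ ≤ _ := mul_le_mul_right hH _
    _ = _ := (ENNReal.liminf_const_mul_of_ne_top ENNReal.ofReal_ne_top).symm
    _ ≤ _ := by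
        refine liminf_le_liminf (v := fun m : ℕ => ENNReal.ofReal (128 * n ^ n) *
          ∫⁻ x in fund n ∩ {x | |φ x| ≤ 4 * n / 2 ^ m} ∩
            {x | ‖gradient φ x‖ ∈ Ioc (a / 2) (4 * a)},
            ENNReal.ofReal (‖gradient φ x‖ ^ 3 / (4 * n / 2 ^ m))) ?_
        filter_upwards [hN, hN0, (tendsto_order.1 hlim).2 δ hδ] with m hm hm0 hmδ
        have hε : 4 * a * ((n : ℝ) / N m) = 4 * n / 2 ^ m := by
          rw [hm]; field_simp
        rw [← hε]
        refine sum_ediam_rpow_le hn hφ ha hm0 ?_ fun x hx => hx.2.1.le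
        rintro j ⟨x, hxj, hxf, hx0, hxa⟩
        refine gridCell_subset_of_mem (hφ.differentiable (by simp)) ha hxj hx0 hxa fun y hy => ?_
        refine hosc x (hfK hxf) y (hfK (gridCell_subset_fund _ j hy)) ?_
        exact (dist_le_of_mem_gridCell hxj hy).trans_lt (by rwa [hm])
    _ = _ := ENNReal.liminf_const_mul_of_ne_top ENNReal.ofReal_ne_top

end Covering

section Assembly

lemma zeroSet_union_iUnion_dyadic_eq_univ {α : Type*} {u : α → ℝ} (hu : ∀ x, 0 ≤ u x) :
    ({x | u x = 0} ∪ ⋃ k : ℤ, {x | u x ∈ Ioc ((2 : ℝ) ^ k) (2 * 2 ^ k)}) = Set.univ := by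
  refine eq_univ_of_forall fun x => ?_
  rcases (hu x).eq_or_lt with h | h
  · exact Or.inl h.symm
  · obtain ⟨k, hk⟩ := exists_mem_Ioc_zpow h one_lt_two
    refine Or.inr (mem_iUnion.2 ⟨k, ?_⟩)
    rwa [zpow_add_one₀ two_ne_zero, mul_comm] at hk

/-- Integrals over dyadic shells enlarged by a factor two sum to at most three times the total. -/
lemma tsum_setLIntegral_dyadic_le {α : Type*} [MeasurableSpace α] {μ : Measure α} {u : α → ℝ}
    (hu : Measurable u) (B : Set α) (f : α → ℝ≥0∞) :
    ∑' k : ℤ, ∫⁻ x in B ∩ {x | u x ∈ Ioc ((2 : ℝ) ^ k / 2) (4 * 2 ^ k)}, f x ∂μ ≤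
      3 * ∫⁻ x in B, f x ∂μ := by
  set D : ℤ → Set α := fun k => {x | u x ∈ Ioc ((2 : ℝ) ^ k) (2 ^ (k + 1))} with hD
  have hDm : ∀ k, MeasurableSet (D k) := fun k => hu measurableSet_Ioc
  have hDd : Pairwise (Function.onFun Disjoint D) := by
    intro k l hkl
    rw [Function.onFun, Set.disjoint_left]
    intro x hx hy
    have h1 := (zpow_lt_zpow_iff_right₀ (one_lt_two (α := ℝ))).1 (hx.1.trans_le hy.2)
    have h2 := (zpow_lt_zpow_iff_right₀ (one_lt_two (α := ℝ))).1 (hy.1.trans_le hx.2)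
    omega
  set I : ℤ → ℝ≥0∞ := fun k => ∫⁻ x in D k, f x ∂(μ.restrict B) with hI
  have hIsum : ∑' k, I k ≤ ∫⁻ x in B, f x ∂μ := by
    rw [← lintegral_iUnion hDm hDd]
    exact setLIntegral_le_lintegral _ _
  have hle : ∀ k : ℤ, ∫⁻ x in B ∩ {x | u x ∈ Ioc ((2 : ℝ) ^ k / 2) (4 * 2 ^ k)}, f x ∂μ ≤
      I (k - 1) + I k + I (k + 1) := by
    intro k
    have hm : MeasurableSet {x | u x ∈ Ioc ((2 : ℝ) ^ k / 2) (4 * 2 ^ k)} := hu measurableSet_Ioc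
    rw [inter_comm, ← Measure.restrict_restrict hm]
    have hsub : {x | u x ∈ Ioc ((2 : ℝ) ^ k / 2) (4 * 2 ^ k)} ⊆ D (k - 1) ∪ D k ∪ D (k + 1) := by
      intro x hx
      have e1 : (2 : ℝ) ^ (k - 1) = 2 ^ k / 2 := by rw [zpow_sub_one₀ two_ne_zero]; rfl
      have e2 : (2 : ℝ) ^ (k + 1 + 1) = 4 * 2 ^ k := by
        rw [zpow_add_one₀ two_ne_zero, zpow_add_one₀ two_ne_zero]; ring
      rcases le_or_gt (u x) (2 ^ k) with h1 | h1
      · refine Or.inl (Or.inl ⟨e1 ▸ hx.1, ?_⟩)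
        rwa [sub_add_cancel]
      · rcases le_or_gt (u x) (2 ^ (k + 1)) with h2 | h2
        · exact Or.inl (Or.inr ⟨h1, h2⟩)
        · exact Or.inr ⟨h2, e2 ▸ hx.2⟩
    refine (lintegral_mono_set hsub).trans ((lintegral_union_le _ _ _).trans ?_)
    gcongr
    exact lintegral_union_le _ _ _
  calc _ ≤ ∑' k, (I (k - 1) + I k + I (k + 1)) := ENNReal.tsum_le_tsum hle
    _ = ∑' k, I (k - 1) + ∑' k, I k + ∑' k, I (k + 1) := by
        rw [ENNReal.tsum_add, ENNReal.tsum_add]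
    _ = 3 * ∑' k, I k := by
        have e1 : ∑' k, I (k - 1) = ∑' k, I k := (Equiv.subRight (1 : ℤ)).tsum_eq I
        have e2 : ∑' k, I (k + 1) = ∑' k, I k := (Equiv.addRight (1 : ℤ)).tsum_eq I
        rw [e1, e2]; ring
    _ ≤ _ := by gcongr

lemma tsum_liminf_le_liminf_tsum {ι : Type*} (F : ℕ → ι → ℝ≥0∞) :
    ∑' k, liminf (fun m => F m k) atTop ≤ liminf (fun m => ∑' k, F m k) atTop := by
  let _ : MeasurableSpace ι := ⊤
  have : MeasurableSingletonClass ι := ⟨fun _ => trivial⟩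
  simp only [← lintegral_count]
  exact lintegral_liminf_le fun m => measurable_from_top

end Assembly

/-- **Upper bound on the gradient integral over the nodal set.** There is
C = C(n) > 0 such that every L²-normalized torus eigenfunction with frequency
λ ≥ 1 satisfies ∫_{Z_φ} |∇φ|² dH^{n-1} ≤ C λ³. -/
theorem torus_nodal_gradient_upper_bound {n : ℕ} (hn : 2 ≤ n) :
    ∃ C > (0 : ℝ), ∀ lam : ℝ, 1 ≤ lam →
      ∀ φ : EuclideanSpace ℝ (Fin n) → ℝ, IsTorusEigenfunction lam φ →
        (∫ x in fund n, (φ x) ^ 2) = 1 →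
        (∫⁻ x in {x ∈ fund n | φ x = 0}, ENNReal.ofReal (‖gradient φ x‖ ^ 2) ∂μH[(n:ℝ)-1])
          ≤ ENNReal.ofReal (C * lam ^ 3) := by
  refine ⟨128 * n ^ n * (3 * 10), by positivity, fun lam hlam φ hφ hnorm => ?_⟩
  have hs := hφ.1
  have hu := hs.continuous_norm_gradient
  set w : EuclideanSpace ℝ (Fin n) → ℝ≥0∞ := fun x => ENNReal.ofReal (‖gradient φ x‖ ^ 2) with hw
  set S : ℤ → Set (EuclideanSpace ℝ (Fin n)) := fun k =>
    {x ∈ fund n | φ x = 0 ∧ ‖gradient φ x‖ ∈ Ioc ((2 : ℝ) ^ k) (2 * 2 ^ k)} with hS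
  set F : ℕ → ℤ → ℝ≥0∞ := fun m k =>
    ∫⁻ x in fund n ∩ {x | |φ x| ≤ 4 * n / 2 ^ m} ∩
      {x | ‖gradient φ x‖ ∈ Ioc ((2 : ℝ) ^ k / 2) (4 * 2 ^ k)},
      ENNReal.ofReal (‖gradient φ x‖ ^ 3 / (4 * n / 2 ^ m)) with hF
  have hsub : {x ∈ fund n | φ x = 0} ⊆ {x | ‖gradient φ x‖ = 0} ∪ ⋃ k, S k := by
    rintro x ⟨hx, hx0⟩
    rcases (zeroSet_union_iUnion_dyadic_eq_univ (u := fun x => ‖gradient φ x‖)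
      fun x => norm_nonneg _).ge (mem_univ x) with h | h
    · exact Or.inl h
    · obtain ⟨k, hk⟩ := mem_iUnion.1 h
      exact Or.inr (mem_iUnion.2 ⟨k, hx, hx0, hk⟩)
  have hcrit : ∫⁻ x in {x | ‖gradient φ x‖ = 0}, w x ∂μH[(n : ℝ) - 1] = 0 := by
    rw [setLIntegral_congr_fun (g := fun _ => 0)
      (measurableSet_eq_fun hu.measurable measurable_const) fun x hx => ?_, lintegral_zero]
    have hx0 : ‖gradient φ x‖ = 0 := hx
    simp only [hw, hx0]
    simp
  have hlevel : ∀ k, ∫⁻ x in S k, w x ∂μH[(n : ℝ) - 1] ≤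
      ENNReal.ofReal (128 * n ^ n) * liminf (fun m => F m k) atTop := by
    intro k
    refine lintegral_nodal_level_le hn hs (a := 2 ^ k) (by positivity)
      (N := fun m => 2 ^ (k + m).toNat) ?_
    filter_upwards [eventually_ge_atTop (-k).toNat] with m hm
    have : ((k + m).toNat : ℤ) = k + m := Int.toNat_of_nonneg (by omega)
    rw [Nat.cast_pow, Nat.cast_ofNat, ← zpow_natCast, this, zpow_add₀ two_ne_zero, zpow_natCast]
  have hFm : ∀ m, ∑' k, F m k ≤ ENNReal.ofReal (3 * (10 * lam ^ 3)) := by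
    intro m
    have hε : (0 : ℝ) < 4 * n / 2 ^ m := by
      have : (0 : ℝ) < n := by exact_mod_cast (by omega : 0 < n)
      positivity
    refine (tsum_setLIntegral_dyadic_le hu.measurable _ _).trans ?_
    rw [ENNReal.ofReal_mul (by norm_num), ENNReal.ofReal_ofNat]
    gcongr
    exact lintegral_gradient_cube_le (by linarith) hφ hnorm hε
  calc ∫⁻ x in {x ∈ fund n | φ x = 0}, w x ∂μH[(n : ℝ) - 1]
      ≤ ∫⁻ x in {x | ‖gradient φ x‖ = 0}, w x ∂μH[(n : ℝ) - 1] +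
        ∫⁻ x in ⋃ k, S k, w x ∂μH[(n : ℝ) - 1] :=
        (lintegral_mono_set hsub).trans (lintegral_union_le _ _ _)
    _ ≤ ∑' k, ENNReal.ofReal (128 * n ^ n) * liminf (fun m => F m k) atTop := by
        rw [hcrit, zero_add]
        exact (lintegral_iUnion_le _ _).trans (ENNReal.tsum_le_tsum hlevel)
    _ ≤ ENNReal.ofReal (128 * n ^ n) * liminf (fun m => ∑' k, F m k) atTop := by
        rw [ENNReal.tsum_mul_left]
        gcongr
        exact tsum_liminf_le_liminf_tsum F
    _ ≤ ENNReal.ofReal (128 * n ^ n) * ENNReal.ofReal (3 * (10 * lam ^ 3)) := by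
        gcongr
        exact liminf_le_of_frequently_le' (Frequently.of_forall hFm)
    _ = _ := by
        rw [← ENNReal.ofReal_mul (by positivity)]
        congr 1
        ring
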